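/- Let Σ = ∂K be the boundary of a compact convex body K ⊂ ℝ^d (d ≥ 2) with smooth boundary, and suppose Σ is of finite type k ≥ 2. Then there is a constant C > 0, independent of s, such that for every ξ₀ ∈ Σ, every s > 0, and every ξ ∈ B(ξ₀, s), one has (1/C) σ[B(ξ₀, s)] ≤ σ[B(ξ, s)] ≤ C σ[B(ξ₀, s)]. -/

import Mathlib

open MeasureTheory Set
open scoped RealInnerProductSpace ENNReal

noncomputable section

abbrev Euc (d : ℕ) := EuclideanSpace ℝ (Fin d)

/-- `K` is a compact convex body in `ℝ^d` with nonempty interior and smooth boundary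
`Σ = ∂K`, described by the smooth defining function `F`: `K = {F ≤ 0}`,
`∂K = {F = 0}`, and `∇F ≠ 0` on `∂K`. -/
def SmoothBody (d : ℕ) (K : Set (Euc d)) (F : Euc d → ℝ) : Prop :=
  IsCompact K ∧ Convex ℝ K ∧ (interior K).Nonempty ∧
    ContDiff ℝ (⊤ : ℕ∞) F ∧ K = {x | F x ≤ 0} ∧ frontier K = {x | F x = 0} ∧
    ∀ ζ ∈ frontier K, gradient F ζ ≠ 0

/-- `Σ = ∂K` is of finite type `k`: every tangent line makes contact of order at most
`k` with `Σ`, expressed via the defining function `F`. -/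
def FiniteTypeOrd (d k : ℕ) (K : Set (Euc d)) (F : Euc d → ℝ) : Prop :=
  ∀ ζ ∈ frontier K, ∀ v : Euc d, v ≠ 0 → ⟪gradient F ζ, v⟫ = 0 →
    ∃ j : ℕ, 2 ≤ j ∧ j ≤ k ∧ iteratedDeriv j (fun s : ℝ => F (ζ + s • v)) 0 ≠ 0

/-- The outer unit normal `n(ζ) = ∇F(ζ)/|∇F(ζ)|`. -/
def nrml (d : ℕ) (F : Euc d → ℝ) (ζ : Euc d) : Euc d :=
  ‖gradient F ζ‖⁻¹ • gradient F ζ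

/-- The cap `B(ζ,s) = {ξ ∈ Σ : |⟨n(ζ), ξ − ζ⟩| < s}`. -/
def cap (d : ℕ) (K : Set (Euc d)) (F : Euc d → ℝ) (ζ : Euc d) (s : ℝ) : Set (Euc d) :=
  {ξ | ξ ∈ frontier K ∧ |⟪nrml d F ζ, ξ - ζ⟫| < s}

/-- If every point of `A` is related to a point of `B` and the relation expands distances by at
most `L`, then the Hausdorff measure of `A` is at most `L ^ p` times that of `B`. -/
theorem hausdorffMeasure_le_of_rel {X Y : Type*} [MetricSpace X] [MeasurableSpace X]
    [BorelSpace X] [MetricSpace Y] [MeasurableSpace Y] [BorelSpace Y] (R : X → Y → Prop)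
    {A : Set X} {B : Set Y} {L : NNReal} {p : ℝ} (hp : 0 ≤ p)
    (hAB : ∀ x ∈ A, ∃ y ∈ B, R x y)
    (hR : ∀ x ∈ A, ∀ x' ∈ A, ∀ y y', R x y → R x' y' → dist x x' ≤ L * dist y y') :
    μH[p] A ≤ (L : ℝ≥0∞) ^ p * μH[p] B := by
  classical
  rcases A.eq_empty_or_nonempty with rfl | ⟨a, ha⟩
  · simp
  have : Nonempty X := ⟨a⟩
  have : Nonempty Y := ⟨(hAB a ha).choose⟩
  choose! g hgB hg using hAB
  have hinj : InjOn g A := by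
    intro x hx x' hx' h
    have := hR x hx x' hx' _ _ (hg x hx) (hg x' hx')
    rw [h, dist_self, mul_zero] at this
    exact dist_le_zero.1 this
  have hinv := hinj.leftInvOn_invFunOn
  have hlip : LipschitzOnWith L (Function.invFunOn g A) (g '' A) := by
    refine LipschitzOnWith.of_dist_le_mul ?_
    rintro _ ⟨x, hx, rfl⟩ _ ⟨x', hx', rfl⟩
    rw [hinv hx, hinv hx']
    exact hR x hx x' hx' _ _ (hg x hx) (hg x' hx')
  have himg : Function.invFunOn g A '' (g '' A) = A := hinv.image_image
  calc μH[p] A = μH[p] (Function.invFunOn g A '' (g '' A)) := by rw [himg]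
    _ ≤ (L : ℝ≥0∞) ^ p * μH[p] (g '' A) := hlip.hausdorffMeasure_image_le hp
    _ ≤ (L : ℝ≥0∞) ^ p * μH[p] B := by
        gcongr
        rintro _ ⟨x, hx, rfl⟩
        exact hgB x hx

/-- Iterated derivatives in the last variable of a jointly smooth function are jointly smooth. -/
theorem contDiff_uncurry_iteratedDeriv {P : Type*} [NormedAddCommGroup P] [NormedSpace ℝ P]
    {H : P → ℝ → ℝ} (hH : ContDiff ℝ (⊤ : ℕ∞) (Function.uncurry H)) (j : ℕ) :
    ContDiff ℝ (⊤ : ℕ∞) (Function.uncurry fun p t => iteratedDeriv j (H p) t) := by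
  induction j with
  | zero => simpa using hH
  | succ j ih =>
    have h : ContDiff ℝ (⊤ : ℕ∞) (fun q : P × ℝ =>
        fderiv ℝ (fun t => iteratedDeriv j (H q.1) t) q.2 (1 : ℝ)) := by
      have : ContDiff ℝ (⊤ : ℕ∞) (fun q : P × ℝ =>
        fderiv ℝ (fun t => iteratedDeriv j (H q.1) t) q.2) := by
        refine ContDiff.fderiv (n := (⊤ : ℕ∞)) (m := (⊤ : ℕ∞))
          (f := fun (q : P × ℝ) t => iteratedDeriv j (H q.1) t) ?_ contDiff_snd (by simp)
        exact ih.comp ((contDiff_fst.comp contDiff_fst).prodMk contDiff_snd)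
      exact this.clm_apply contDiff_const
    convert h using 1
    ext ⟨p, t⟩
    simp [Function.uncurry, iteratedDeriv_succ]

/-- The coefficients of a polynomial of degree at most `k` are controlled by its values at
the points `(i + 1) / (k + 1)`, `0 ≤ i ≤ k`. -/
theorem exists_coeff_bound (k : ℕ) : ∃ A : ℝ, 0 < A ∧ ∀ (b : ℕ → ℝ) (S : ℝ), 0 ≤ S →
    (∀ x ∈ Ioc (0 : ℝ) 1, |∑ j ∈ Finset.range (k + 1), b j * x ^ j| ≤ S) →
    ∀ j ≤ k, |b j| ≤ A * S := by
  let x : Fin (k + 1) → ℝ := fun i => ((i : ℝ) + 1) / (k + 1)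
  have hx : Function.Injective x := by
    intro i i' h
    have h1 : ((i : ℝ) + 1) / (k + 1) = ((i' : ℝ) + 1) / (k + 1) := h
    have hk : (k : ℝ) + 1 ≠ 0 := by positivity
    rw [div_left_inj' hk] at h1
    have : (i : ℝ) = i' := by linarith
    exact Fin.ext (by exact_mod_cast this)
  let T : (Fin (k + 1) → ℝ) →ₗ[ℝ] (Fin (k + 1) → ℝ) := (Matrix.vandermonde x).mulVecLin
  have hT : LinearMap.ker T = ⊥ := by
    rw [LinearMap.ker_eq_bot']
    intro m hm
    exact Matrix.eq_zero_of_mulVec_eq_zero (Matrix.det_vandermonde_ne_zero_iff.2 hx) hm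
  obtain ⟨A, hA0, hA⟩ := T.exists_antilipschitzWith hT
  refine ⟨A, hA0, fun b S hS hb j hj => ?_⟩
  have h1 := hA.le_mul_dist (fun i : Fin (k + 1) => b i) 0
  rw [map_zero, dist_zero_right, dist_zero_right] at h1
  have h2 : ‖T (fun i : Fin (k + 1) => b i)‖ ≤ S := by
    rw [pi_norm_le_iff_of_nonneg hS]
    intro i
    have := hb (x i) ⟨by simp only [x]; positivity, by
      simp only [x]
      rw [div_le_one (by positivity)]
      have : (i : ℕ) ≤ k := by omega
      have : (i : ℝ) ≤ k := by exact_mod_cast this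
      linarith⟩
    rw [Finset.sum_range] at this
    simpa [T, Matrix.mulVec, dotProduct, Matrix.vandermonde_apply, mul_comm] using this
  calc |b j| = ‖(fun i : Fin (k + 1) => b i) ⟨j, by omega⟩‖ := rfl
    _ ≤ ‖(fun i : Fin (k + 1) => b i)‖ := norm_le_pi_norm (fun i : Fin (k + 1) => b i) ⟨j, by omega⟩
    _ ≤ A * S := h1.trans (by gcongr)

theorem abs_sub_taylor_le {g : ℝ → ℝ} (hg : ContDiff ℝ (⊤ : ℕ∞) g) {k : ℕ} {M : ℝ}
    (hM : ∀ t, |t| ≤ 1 → |iteratedDeriv (k + 1) g t| ≤ M) {x : ℝ} (hx : |x| ≤ 1) :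
    |g x - ∑ j ∈ Finset.range (k + 1), iteratedDeriv j g 0 / (j.factorial : ℝ) * x ^ j|
      ≤ M * |x| ^ (k + 1) := by
  rcases eq_or_ne 0 x with rfl | h0
  · simp [Finset.sum_range_succ']
  have hu := uniqueDiffOn_Icc (show min 0 x < max 0 x by simpa using h0.symm)
  have hE : ∀ (j : ℕ) (y : ℝ), y ∈ uIcc 0 x →
      iteratedDerivWithin j g (uIcc 0 x) y = iteratedDeriv j g y := fun j y hy =>
    iteratedDerivWithin_eq_iteratedDeriv hu (hg.contDiffAt.of_le (by exact_mod_cast le_top)) hy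
  obtain ⟨y, hy, hxy⟩ := taylor_mean_remainder_lagrange (f := g) (n := k) h0
    (hg.contDiffOn.of_le (by exact_mod_cast le_top))
    (((hg.contDiffOn (s := uIcc 0 x)).differentiableOn_iteratedDerivWithin (by exact_mod_cast ENat.natCast_lt_top k)
      hu).mono uIoo_subset_uIcc_self)
  have hy' := uIoo_subset_uIcc_self hy
  have hsum : taylorWithinEval g k (uIcc 0 x) 0 x =
      ∑ j ∈ Finset.range (k + 1), iteratedDeriv j g 0 / (j.factorial : ℝ) * x ^ j := by
    rw [taylor_within_apply]
    refine Finset.sum_congr rfl fun j _ => ?_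
    rw [hE j 0 left_mem_uIcc, smul_eq_mul, sub_zero]
    ring
  rw [← hsum, hxy, hE _ y hy', sub_zero, abs_div, abs_mul, abs_pow]
  have hy1 : |y| ≤ 1 := by
    have := abs_sub_left_of_mem_uIcc hy'
    simp only [sub_zero] at this
    exact this.trans hx
  have h1 : (1 : ℝ) ≤ |((k + 1).factorial : ℝ)| := by
    rw [Nat.abs_cast]; exact_mod_cast Nat.factorial_pos _
  calc _ ≤ |iteratedDeriv (k + 1) g y| * |x| ^ (k + 1) := div_le_self (by positivity) h1
    _ ≤ _ := by gcongr; exact hM y hy1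

/-- A smooth function of one variable which is quantitatively of finite type at `0` and almost
increasing to the right of `0` satisfies a two-sided doubling condition near `0`. -/
theorem exists_doubling_of_finite_type (k : ℕ) {c M B : ℝ} (hc : 0 < c) (hM : 0 < M) (hB : 0 < B) :
    ∃ r C : ℝ, 0 < r ∧ 0 < C ∧ ∀ g : ℝ → ℝ, ContDiff ℝ (⊤ : ℕ∞) g →
      (∃ j ≤ k, c ≤ |iteratedDeriv j g 0|) →
      (∀ t, |t| ≤ 1 → |iteratedDeriv (k + 1) g t| ≤ M) →
      ∀ t, 0 < t → t < r → (∀ τ ∈ Ioc (0 : ℝ) 1, |g (τ * t)| ≤ B * g t) →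
      0 < g t ∧ ∀ l : ℝ, |l| ≤ 4 → g (l * t) ≤ C * g t := by
  obtain ⟨A, hA, hcoef⟩ := exists_coeff_bound k
  set c' : ℝ := c / (k.factorial : ℝ) with hc'
  have hc'0 : 0 < c' := by positivity
  set r : ℝ := min (1 / 4) (c' / (2 * A * M)) with hr
  have hr0 : 0 < r := by positivity
  refine ⟨r, ((k + 1) * 4 ^ k + 4 ^ (k + 1) / (2 * A)) * (2 * A * B), hr0, by positivity, ?_⟩
  rintro g hg ⟨j₀, hj₀, hcj⟩ hgM t ht0 htr hmono
  have ht4 : t < 1 / 4 := htr.trans_le (min_le_left _ _)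
  have htM : 2 * A * M * t ≤ c' := by
    have := (htr.trans_le (min_le_right _ _)).le
    rw [le_div_iff₀ (by positivity)] at this
    linarith
  set b : ℕ → ℝ := fun j => iteratedDeriv j g 0 / (j.factorial : ℝ) * t ^ j with hb
  have htaylor : ∀ l : ℝ, |l| ≤ 4 →
      |g (l * t) - ∑ j ∈ Finset.range (k + 1), b j * l ^ j| ≤ M * |l| ^ (k + 1) * t ^ (k + 1) := by
    intro l hl
    have h1 : |l * t| ≤ 1 := by
      rw [abs_mul, abs_of_pos ht0]; nlinarith [abs_nonneg l]
    have := abs_sub_taylor_le hg hgM h1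
    rw [abs_mul l t, abs_of_pos ht0, mul_pow, ← mul_assoc] at this
    have hs : ∑ j ∈ Finset.range (k + 1), iteratedDeriv j g 0 / (j.factorial : ℝ) * (l * t) ^ j
        = ∑ j ∈ Finset.range (k + 1), b j * l ^ j :=
      Finset.sum_congr rfl fun j _ => by simp only [hb]; ring
    rwa [hs] at this
  have hgt : 0 ≤ g t := by
    have := (abs_nonneg _).trans (hmono 1 ⟨one_pos, le_rfl⟩)
    exact nonneg_of_mul_nonneg_right this hB
  have hN : ∀ j ≤ k, |b j| ≤ A * (B * g t + M * t ^ (k + 1)) := by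
    refine hcoef b _ (by positivity) fun x hx => ?_
    have hxa : |x| ≤ 1 := by rw [abs_of_pos hx.1]; exact hx.2
    have h1 := htaylor x (hxa.trans (by norm_num))
    have h2 := hmono x hx
    have h3 : M * |x| ^ (k + 1) * t ^ (k + 1) ≤ M * t ^ (k + 1) := by
      have : |x| ^ (k + 1) ≤ 1 := pow_le_one₀ (abs_nonneg _) hxa
      have h4 : 0 < M * t ^ (k + 1) := by positivity
      nlinarith
    rw [abs_le] at *
    constructor <;> linarith
  have hlow : c' * t ^ k ≤ |b j₀| := by
    simp only [hb]
    rw [abs_mul, abs_div, Nat.abs_cast, abs_of_pos (pow_pos ht0 _)]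
    have h1 : t ^ k ≤ t ^ j₀ := pow_le_pow_of_le_one ht0.le (by linarith) hj₀
    have h2 : c' ≤ |iteratedDeriv j₀ g 0| / (j₀.factorial : ℝ) := by
      rw [hc']
      have : (j₀.factorial : ℝ) ≤ k.factorial := by exact_mod_cast Nat.factorial_le hj₀
      gcongr
    gcongr
  have hrem : 2 * A * (M * t ^ (k + 1)) ≤ c' * t ^ k := by
    calc 2 * A * (M * t ^ (k + 1)) = (2 * A * M * t) * t ^ k := by ring
      _ ≤ c' * t ^ k := by gcongr
  have hlow2 : c' * t ^ k ≤ 2 * A * B * g t := by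
    have := hN j₀ hj₀
    nlinarith
  have hpos : 0 < g t := by
    have : 0 < c' * t ^ k := by positivity
    have h2 : 0 < 2 * A * B * g t := this.trans_le hlow2
    exact pos_of_mul_pos_right h2 (by positivity)
  refine ⟨hpos, fun l hl => ?_⟩
  have hbj : ∀ j ≤ k, |b j| ≤ 2 * A * B * g t := by
    intro j hj
    have := hN j hj
    nlinarith
  have hsum : ∑ j ∈ Finset.range (k + 1), b j * l ^ j ≤ (k + 1) * 4 ^ k * (2 * A * B * g t) := by
    calc ∑ j ∈ Finset.range (k + 1), b j * l ^ j
        ≤ ∑ j ∈ Finset.range (k + 1), 4 ^ k * (2 * A * B * g t) := by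
          refine Finset.sum_le_sum fun j hj => ?_
          have hj' : j ≤ k := Nat.lt_succ_iff.1 (Finset.mem_range.1 hj)
          have h1 : |l| ^ j ≤ 4 ^ k :=
            (pow_le_pow_left₀ (abs_nonneg _) hl j).trans (pow_le_pow_right₀ (by norm_num) hj')
          calc b j * l ^ j ≤ |b j * l ^ j| := le_abs_self _
            _ = |l| ^ j * |b j| := by rw [abs_mul, abs_pow, mul_comm]
            _ ≤ 4 ^ k * (2 * A * B * g t) := by gcongr; exact hbj j hj'
      _ = _ := by simp; ring
  have hrem2 : M * |l| ^ (k + 1) * t ^ (k + 1) ≤ 4 ^ (k + 1) / (2 * A) * (2 * A * B * g t) := by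
    have h1 : |l| ^ (k + 1) ≤ 4 ^ (k + 1) := pow_le_pow_left₀ (abs_nonneg _) hl _
    have h2 : M * t ^ (k + 1) ≤ (2 * A * B * g t) / (2 * A) := by
      rw [le_div_iff₀ (by positivity)]; linarith
    calc M * |l| ^ (k + 1) * t ^ (k + 1) = |l| ^ (k + 1) * (M * t ^ (k + 1)) := by ring
      _ ≤ 4 ^ (k + 1) * ((2 * A * B * g t) / (2 * A)) := by gcongr
      _ = _ := by ring
  have := (abs_le.1 (htaylor l hl)).2
  calc g (l * t) ≤ (k + 1) * 4 ^ k * (2 * A * B * g t)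
        + 4 ^ (k + 1) / (2 * A) * (2 * A * B * g t) := by linarith
    _ = _ := by ring

theorem exists_inner_gradient_eq {d : ℕ} {F : Euc d → ℝ} (hF : Differentiable ℝ F)
    (x w : Euc d) : ∃ τ ∈ Icc (0 : ℝ) 1, F (x + w) - F x = ⟪gradient F (x + τ • w), w⟫ := by
  obtain ⟨z, hz, h⟩ := domain_mvt (f := F) (f' := fun x => fderiv ℝ F x) (s := univ) (x := x)
    (y := x + w) (fun y _ => (hF y).hasFDerivAt.hasFDerivWithinAt) convex_univ (mem_univ _)
    (mem_univ _)
  rw [segment_eq_image'] at hz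
  obtain ⟨τ, hτ, rfl⟩ := hz
  refine ⟨τ, hτ, ?_⟩
  simp only [add_sub_cancel_left] at h ⊢
  rw [h, gradient, InnerProductSpace.toDual_symm_apply]

theorem continuous_gradient {d : ℕ} {F : Euc d → ℝ} (hF : ContDiff ℝ (⊤ : ℕ∞) F) :
    Continuous (gradient F) :=
  (InnerProductSpace.toDual ℝ (Euc d)).symm.continuous.comp
    (hF.continuous_fderiv (by simp))

namespace SmoothBody

section

variable {d : ℕ} {K : Set (Euc d)} {F : Euc d → ℝ}

theorem contDiff (hK : SmoothBody d K F) : ContDiff ℝ (⊤ : ℕ∞) F := hK.2.2.2.1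

theorem differentiable (hK : SmoothBody d K F) : Differentiable ℝ F :=
  hK.contDiff.differentiable (by simp)

theorem mem_iff (hK : SmoothBody d K F) {x : Euc d} : x ∈ K ↔ F x ≤ 0 :=
  Set.ext_iff.1 hK.2.2.2.2.1 x

theorem mem_frontier_iff (hK : SmoothBody d K F) {x : Euc d} : x ∈ frontier K ↔ F x = 0 :=
  Set.ext_iff.1 hK.2.2.2.2.2.1 x

theorem mem_of_mem_frontier (hK : SmoothBody d K F) {x : Euc d} (hx : x ∈ frontier K) : x ∈ K :=
  hK.mem_iff.2 (hK.mem_frontier_iff.1 hx).le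

theorem isCompact_frontier (hK : SmoothBody d K F) : IsCompact (frontier K) :=
  hK.1.of_isClosed_subset isClosed_frontier fun _ hx => hK.mem_of_mem_frontier hx

theorem norm_gradient_pos (hK : SmoothBody d K F) {ζ : Euc d} (hζ : ζ ∈ frontier K) :
    0 < ‖gradient F ζ‖ := norm_pos_iff.2 (hK.2.2.2.2.2.2 ζ hζ)

theorem norm_nrml (hK : SmoothBody d K F) {ζ : Euc d} (hζ : ζ ∈ frontier K) :
    ‖nrml d F ζ‖ = 1 := by
  have := hK.norm_gradient_pos hζ
  rw [nrml, norm_smul, norm_inv, norm_norm, inv_mul_cancel₀ this.ne']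

theorem inner_nrml_self (hK : SmoothBody d K F) {ζ : Euc d} (hζ : ζ ∈ frontier K) :
    ⟪nrml d F ζ, nrml d F ζ⟫ = 1 := by
  rw [real_inner_self_eq_norm_sq, hK.norm_nrml hζ, one_pow]

theorem gradient_eq (hK : SmoothBody d K F) {ζ : Euc d} (hζ : ζ ∈ frontier K) :
    gradient F ζ = ‖gradient F ζ‖ • nrml d F ζ := by
  rw [nrml, smul_inv_smul₀ (hK.norm_gradient_pos hζ).ne']

theorem continuousOn_nrml (hK : SmoothBody d K F) : ContinuousOn (nrml d F) (frontier K) := by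
  have h := (continuous_gradient hK.contDiff).continuousOn (s := frontier K)
  exact (h.norm.inv₀ fun ζ hζ => (hK.norm_gradient_pos hζ).ne').smul h

/-- The tangent hyperplane at a boundary point is a supporting hyperplane. -/
theorem inner_nrml_nonneg (hK : SmoothBody d K F) {ζ x : Euc d} (hζ : ζ ∈ frontier K)
    (hx : x ∈ K) : 0 ≤ ⟪nrml d F ζ, ζ - x⟫ := by
  have h1 : HasDerivAt (fun t : ℝ => F (ζ + t • (x - ζ))) ⟪gradient F ζ, x - ζ⟫ 0 := by
    have hl : HasDerivAt (fun t : ℝ => ζ + t • (x - ζ)) (x - ζ) 0 := by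
      simpa using ((hasDerivAt_id (0 : ℝ)).smul_const (x - ζ)).const_add ζ
    have := (hK.differentiable (ζ + (0 : ℝ) • (x - ζ))).hasFDerivAt.comp_hasDerivAt (0 : ℝ) hl
    simp only [zero_smul, add_zero] at this
    rw [gradient, InnerProductSpace.toDual_symm_apply]
    exact this
  have h2 := h1.tendsto_slope_zero_right
  have h3 : ⟪gradient F ζ, x - ζ⟫ ≤ 0 := by
    refine le_of_tendsto h2 ?_
    filter_upwards [Ioo_mem_nhdsGT (show (0 : ℝ) < 1 from one_pos)] with t ht
    have hm : ζ + t • (x - ζ) ∈ K :=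
      hK.2.1.add_smul_sub_mem (hK.mem_of_mem_frontier hζ) hx ⟨ht.1.le, ht.2.le⟩
    have := hK.mem_iff.1 hm
    simp only [zero_add, zero_smul, add_zero, hK.mem_frontier_iff.1 hζ, sub_zero, smul_eq_mul]
    exact mul_nonpos_of_nonneg_of_nonpos (inv_nonneg.2 ht.1.le) this
  rw [hK.gradient_eq hζ, real_inner_smul_left] at h3
  have h4 := nonpos_of_mul_nonpos_right h3 (hK.norm_gradient_pos hζ)
  rw [← neg_sub, inner_neg_right] at h4
  linarith

theorem nonneg_of_tangent (hK : SmoothBody d K F) {ζ v : Euc d} (hζ : ζ ∈ frontier K)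
    (hv : ⟪nrml d F ζ, v⟫ = 0) : 0 ≤ F (ζ + v) := by
  by_contra! h
  have hc : ContinuousAt (fun t : ℝ => F (ζ + v + t • nrml d F ζ)) 0 := by
    have := hK.contDiff.continuous
    fun_prop
  have h0 : F (ζ + v + (0 : ℝ) • nrml d F ζ) < 0 := by simpa using h
  have hev := hc.eventually (gt_mem_nhds h0)
  have hev' : ∀ᶠ t : ℝ in nhdsWithin 0 (Ioi 0), F (ζ + v + t • nrml d F ζ) < 0 :=
    hev.filter_mono nhdsWithin_le_nhds
  obtain ⟨t, ht, ht0⟩ := (hev'.and self_mem_nhdsWithin).exists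
  have := hK.inner_nrml_nonneg hζ (hK.mem_iff.2 ht.le)
  rw [show ζ - (ζ + v + t • nrml d F ζ) = -v - t • nrml d F ζ by abel, inner_sub_right,
    inner_neg_right, hv, real_inner_smul_right, hK.inner_nrml_self hζ] at this
  have : (0 : ℝ) < t := ht0
  linarith

/-- Moving outwards along normals expands distances. -/
theorem dist_le_dist_add_nrml (hK : SmoothBody d K F) {x x' : Euc d} (hx : x ∈ frontier K)
    (hx' : x' ∈ frontier K) {t t' : ℝ} (ht : 0 ≤ t) (ht' : 0 ≤ t') :
    dist x x' ≤ dist (x + t • nrml d F x) (x' + t' • nrml d F x') := by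
  rw [dist_eq_norm, dist_eq_norm]
  have h1 := hK.inner_nrml_nonneg hx (hK.mem_of_mem_frontier hx')
  have h2 := hK.inner_nrml_nonneg hx' (hK.mem_of_mem_frontier hx)
  have h3 : ‖x - x'‖ * ‖x - x'‖ ≤
      ‖x + t • nrml d F x - (x' + t' • nrml d F x')‖ * ‖x - x'‖ := by
    refine le_trans ?_ (real_inner_le_norm _ _)
    rw [show x + t • nrml d F x - (x' + t' • nrml d F x')
      = (x - x') + t • nrml d F x - t' • nrml d F x' by abel, inner_sub_left, inner_add_left,
      real_inner_smul_left, real_inner_smul_left, real_inner_self_eq_norm_mul_norm]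
    rw [← neg_sub x x', inner_neg_right] at h2
    nlinarith [mul_nonneg ht h1, mul_nonneg ht' h2]
  rcases eq_or_ne x x' with rfl | hne
  · simp
  · exact le_of_mul_le_mul_right h3 (norm_pos_iff.2 (sub_ne_zero.2 hne))

end

end SmoothBody

/-- On the `r`-ball about any boundary point `ζ`, the derivative of `F` in the direction of the
normal at `ζ` is at least `c`, and the gradient of `F` is at most `L`. -/
structure NormalBounds (d : ℕ) (K : Set (Euc d)) (F : Euc d → ℝ) (r c L : ℝ) : Prop where
  pos_r : 0 < r
  pos_c : 0 < c
  pos_L : 0 < L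
  le_inner : ∀ ζ ∈ frontier K, ∀ x, ‖x - ζ‖ < r → c ≤ ⟪gradient F x, nrml d F ζ⟫
  norm_le : ∀ ζ ∈ frontier K, ∀ x, ‖x - ζ‖ < r → ‖gradient F x‖ ≤ L

theorem SmoothBody.exists_normalBounds {d : ℕ} {K : Set (Euc d)} {F : Euc d → ℝ}
    (hK : SmoothBody d K F) : ∃ r c L, NormalBounds d K F r c L := by
  have hg := continuous_gradient hK.contDiff
  obtain ⟨c, hc, hcΓ⟩ := hK.isCompact_frontier.exists_forall_le' hg.norm.continuousOn
    (fun ζ hζ => hK.norm_gradient_pos hζ)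
  obtain ⟨L, hL⟩ := hK.isCompact_frontier.exists_bound_of_continuousOn hg.continuousOn
  have hU := hK.isCompact_frontier.uniformContinuousAt_of_continuousAt (gradient F)
    (fun ζ _ => hg.continuousAt) (Metric.dist_mem_uniformity (half_pos hc))
  obtain ⟨r, hr, hrU⟩ := Metric.mem_uniformity_dist.1 hU
  have hclose : ∀ ζ ∈ frontier K, ∀ x, ‖x - ζ‖ < r → ‖gradient F x - gradient F ζ‖ < c / 2 := by
    intro ζ hζ x hx
    have h1 : dist ζ x < r := by rwa [dist_comm, dist_eq_norm]
    have h2 := hrU h1 hζ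
    simp only [mem_ofPred_eq] at h2
    rwa [dist_comm, dist_eq_norm] at h2
  refine ⟨r, c / 2, |L| + c / 2, hr, half_pos hc, by positivity, fun ζ hζ x hx => ?_,
    fun ζ hζ x hx => ?_⟩
  · have h1 := hclose ζ hζ x hx
    have h2 : ⟪gradient F ζ, nrml d F ζ⟫ = ‖gradient F ζ‖ := by
      conv_lhs => rw [hK.gradient_eq hζ]
      rw [real_inner_smul_left, hK.inner_nrml_self hζ, mul_one]
    have h3 := (abs_le.1 (abs_real_inner_le_norm (gradient F x - gradient F ζ) (nrml d F ζ))).1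
    rw [hK.norm_nrml hζ, mul_one, inner_sub_left, h2] at h3
    linarith [hcΓ ζ hζ]
  · have h1 := hclose ζ hζ x hx
    have h2 := norm_sub_norm_le (gradient F x) (gradient F ζ)
    linarith [hL ζ hζ, le_abs_self L]

namespace NormalBounds

section

variable {d : ℕ} {K : Set (Euc d)} {F : Euc d → ℝ} {r c L : ℝ}

theorem norm_combo_lt {ζ x w : Euc d} (hx : ‖x - ζ‖ < r) (hxw : ‖x + w - ζ‖ < r) {τ : ℝ}
    (hτ : τ ∈ Icc (0 : ℝ) 1) : ‖x + τ • w - ζ‖ < r := by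
  have := (convex_ball ζ r).add_smul_mem (x := x) (y := w) (by simpa [dist_eq_norm] using hx)
    (by simpa [dist_eq_norm] using hxw) hτ
  simpa [dist_eq_norm] using this

theorem abs_sub_le (hN : NormalBounds d K F r c L) (hK : SmoothBody d K F) {ζ x : Euc d}
    (hζ : ζ ∈ frontier K) (hx : ‖x - ζ‖ < r) : |F x| ≤ L * ‖x - ζ‖ := by
  obtain ⟨τ, hτ, h⟩ := exists_inner_gradient_eq hK.differentiable ζ (x - ζ)
  rw [add_sub_cancel, hK.mem_frontier_iff.1 hζ, sub_zero] at h
  rw [h]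
  refine (abs_real_inner_le_norm _ _).trans ?_
  have := hN.norm_le ζ hζ (ζ + τ • (x - ζ))
    (norm_combo_lt (by simpa using hN.pos_r) (by simpa using hx) hτ)
  gcongr

theorem le_sub (hN : NormalBounds d K F r c L) (hK : SmoothBody d K F) {ζ x : Euc d}
    (hζ : ζ ∈ frontier K) {a : ℝ} (ha : 0 ≤ a) (hx : ‖x - ζ‖ < r)
    (hxa : ‖x + a • nrml d F ζ - ζ‖ < r) : c * a ≤ F (x + a • nrml d F ζ) - F x := by
  obtain ⟨τ, hτ, h⟩ := exists_inner_gradient_eq hK.differentiable x (a • nrml d F ζ)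
  rw [h, real_inner_smul_right, mul_comm]
  exact mul_le_mul_of_nonneg_left (hN.le_inner ζ hζ _ (norm_combo_lt hx hxa hτ)) ha

theorem sub_le (hN : NormalBounds d K F r c L) (hK : SmoothBody d K F) {ζ x : Euc d}
    (hζ : ζ ∈ frontier K) {a : ℝ} (ha : 0 ≤ a) (hx : ‖x - ζ‖ < r)
    (hxa : ‖x + a • nrml d F ζ - ζ‖ < r) : F (x + a • nrml d F ζ) - F x ≤ L * a := by
  obtain ⟨τ, hτ, h⟩ := exists_inner_gradient_eq hK.differentiable x (a • nrml d F ζ)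
  rw [h]
  refine (real_inner_le_norm _ _).trans ?_
  rw [norm_smul, hK.norm_nrml hζ, mul_one, Real.norm_of_nonneg ha]
  exact mul_le_mul_of_nonneg_right (hN.norm_le ζ hζ _ (norm_combo_lt hx hxa hτ)) ha

theorem le_inner_nrml (hN : NormalBounds d K F r c L) (hK : SmoothBody d K F) {ζ x : Euc d}
    (hζ : ζ ∈ frontier K) (hx : x ∈ frontier K) (hxζ : ‖x - ζ‖ < r) :
    c / L ≤ ⟪nrml d F ζ, nrml d F x⟫ := by
  have h1 := hN.le_inner ζ hζ x hxζ
  have h2 := hN.norm_le ζ hζ x hxζ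
  have h0 := hN.pos_c
  have h3 := hK.norm_gradient_pos hx
  rw [hK.gradient_eq hx, real_inner_smul_left, real_inner_comm] at h1
  have h4 : 0 < ⟪nrml d F ζ, nrml d F x⟫ := pos_of_mul_pos_right (h0.trans_le h1) h3.le
  rw [div_le_iff₀ hN.pos_L]
  nlinarith

/-- A point slightly above the tangent hyperplane lies in `K` once it is deep enough. -/
theorem sub_smul_mem (hN : NormalBounds d K F r c L) (hK : SmoothBody d K F) {ζ x : Euc d}
    (hζ : ζ ∈ frontier K) {a : ℝ} (ha : 0 ≤ a) (hx : ‖x - ζ‖ < r)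
    (hxa : ‖x - a • nrml d F ζ - ζ‖ < r) (hF : F x ≤ c * a) : x - a • nrml d F ζ ∈ K := by
  have := hN.le_sub hK hζ ha hxa (by simpa using hx)
  rw [sub_add_cancel] at this
  exact hK.mem_iff.2 (by linarith)

/-- On the tangent hyperplane `F` is almost increasing along rays from the point of contact. -/
theorem abs_le_of_tangent (hN : NormalBounds d K F r c L) (hK : SmoothBody d K F) {ζ v : Euc d}
    (hζ : ζ ∈ frontier K) (hv : ⟪nrml d F ζ, v⟫ = 0) (hvr : (1 + L / c) * ‖v‖ < r)
    {τ : ℝ} (hτ : τ ∈ Icc (0 : ℝ) 1) : |F (ζ + τ • v)| ≤ L / c * F (ζ + v) := by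
  have hc := hN.pos_c
  have hL := hN.pos_L
  have hvr' : ‖v‖ < r := by
    have : 0 ≤ L / c * ‖v‖ := by positivity
    linarith
  have h0 := hK.nonneg_of_tangent hζ hv
  set a := F (ζ + v) / c with ha
  have ha0 : 0 ≤ a := by positivity
  have hF : F (ζ + v) ≤ L * ‖v‖ := by
    have := hN.abs_sub_le hK hζ (x := ζ + v) (by simpa using hvr')
    rw [add_sub_cancel_left] at this
    exact (le_abs_self _).trans this
  have ha1 : a ≤ L / c * ‖v‖ := by
    rw [ha, div_mul_eq_mul_div]; gcongr
  have hlt : ‖v - a • nrml d F ζ‖ < r := by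
    refine (norm_sub_le _ _).trans_lt ?_
    rw [norm_smul, hK.norm_nrml hζ, mul_one, Real.norm_of_nonneg ha0]
    linarith
  have hmem : ζ + v - a • nrml d F ζ ∈ K := by
    refine hN.sub_smul_mem hK hζ ha0 (by simpa using hvr') ?_ ?_
    · rwa [show ζ + v - a • nrml d F ζ - ζ = v - a • nrml d F ζ by abel]
    · rw [ha, mul_div_cancel₀ _ hc.ne']
  have hmem2 := hK.2.1.add_smul_mem (hK.mem_of_mem_frontier hζ)
    (y := v - a • nrml d F ζ) (by rwa [← add_sub_assoc]) hτ
  have hτv : ‖τ • v‖ < r := by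
    rw [norm_smul, Real.norm_of_nonneg hτ.1]
    nlinarith [hτ.1, hτ.2, norm_nonneg v]
  have hτlt : ‖τ • (v - a • nrml d F ζ)‖ < r := by
    rw [norm_smul, Real.norm_of_nonneg hτ.1]
    nlinarith [hτ.1, hτ.2, norm_nonneg (v - a • nrml d F ζ)]
  have heq : ζ + τ • (v - a • nrml d F ζ) + (τ * a) • nrml d F ζ = ζ + τ • v := by
    rw [smul_sub, smul_smul]; abel
  have h1 := hN.sub_le hK hζ (x := ζ + τ • (v - a • nrml d F ζ)) (a := τ * a)
    (mul_nonneg hτ.1 ha0) (by simpa using hτlt) (by rw [heq]; simpa using hτv)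
  rw [heq] at h1
  have h2 := hK.mem_iff.1 hmem2
  have h3 : 0 ≤ F (ζ + τ • v) :=
    hK.nonneg_of_tangent hζ (by rw [real_inner_smul_right, hv, mul_zero])
  rw [abs_of_nonneg h3]
  calc F (ζ + τ • v) ≤ L * (τ * a) := by linarith
    _ ≤ L * a := by
        have : τ * a ≤ a := mul_le_of_le_one_left ha0 hτ.2
        gcongr
    _ = L / c * F (ζ + v) := by rw [ha]; ring

end

end NormalBounds

/-- The finite type condition holds uniformly along unit tangent directions. -/
theorem SmoothBody.exists_uniform_type {d k : ℕ} {K : Set (Euc d)} {F : Euc d → ℝ}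
    (hK : SmoothBody d K F) (hft : FiniteTypeOrd d k K F) :
    ∃ c M : ℝ, 0 < c ∧ 0 < M ∧ ∀ ζ ∈ frontier K, ∀ u : Euc d, ‖u‖ = 1 →
      ⟪nrml d F ζ, u⟫ = 0 →
      (∃ j ≤ k, c ≤ |iteratedDeriv j (fun t : ℝ => F (ζ + t • u)) 0|) ∧
      ∀ t, |t| ≤ 1 → |iteratedDeriv (k + 1) (fun t : ℝ => F (ζ + t • u)) t| ≤ M := by
  let Q : Set (Euc d × Euc d) :=
    (frontier K ×ˢ Metric.sphere 0 1) ∩ {p | ⟪gradient F p.1, p.2⟫ = 0}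
  have hgc := continuous_gradient hK.contDiff
  have hQ : IsCompact Q :=
    (hK.isCompact_frontier.prod (isCompact_sphere 0 1)).inter_right
      (isClosed_eq (by fun_prop) continuous_const)
  let H : Euc d × Euc d → ℝ → ℝ := fun p t => F (p.1 + t • p.2)
  have hH : ContDiff ℝ (⊤ : ℕ∞) (Function.uncurry H) := by
    have := hK.contDiff
    have h2 : ContDiff ℝ (⊤ : ℕ∞) (fun q : (Euc d × Euc d) × ℝ => q.1.1 + q.2 • q.1.2) := by
      fun_prop
    exact this.comp h2
  have hcont : ∀ j, Continuous (Function.uncurry fun p t => iteratedDeriv j (H p) t) :=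
    fun j => (contDiff_uncurry_iteratedDeriv hH j).continuous
  have hsumc : Continuous fun p => ∑ j ∈ Finset.range (k + 1), |iteratedDeriv j (H p) 0| := by
    refine continuous_finsetSum _ fun j _ => Continuous.abs ?_
    exact (hcont j).comp (continuous_id.prodMk continuous_const)
  obtain ⟨m, hm, hmQ⟩ := hQ.exists_forall_le' (a := 0) hsumc.continuousOn (by
    rintro ⟨ζ, u⟩ ⟨⟨hζ, hu⟩, h0⟩
    have hu0 : u ≠ 0 := by
      rintro rfl
      simp at hu
    obtain ⟨j, -, hjk, hj⟩ := hft ζ hζ u hu0 h0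
    exact (abs_pos.2 hj).trans_le (Finset.single_le_sum
      (f := fun j => |iteratedDeriv j (H (ζ, u)) 0|) (fun i _ => abs_nonneg _)
      (Finset.mem_range.2 (Nat.lt_succ_of_le hjk))))
  obtain ⟨M, hM⟩ := (hQ.prod (isCompact_Icc (a := (-1 : ℝ)) (b := 1))).exists_bound_of_continuousOn
    (hcont (k + 1)).continuousOn
  refine ⟨m / (k + 1), |M| + 1, by positivity, by positivity, fun ζ hζ u hu hζu => ?_⟩
  have hmem : (ζ, u) ∈ Q := by
    refine ⟨⟨hζ, by simpa using hu⟩, ?_⟩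
    show ⟪gradient F ζ, u⟫ = 0
    rw [hK.gradient_eq hζ, real_inner_smul_left, hζu, mul_zero]
  constructor
  · by_contra! hlt
    have h1 : ∑ j ∈ Finset.range (k + 1), |iteratedDeriv j (H (ζ, u)) 0|
        < ∑ j ∈ Finset.range (k + 1), m / (k + 1) :=
      Finset.sum_lt_sum_of_nonempty ⟨0, by simp⟩
        fun j hj => hlt j (Nat.lt_succ_iff.1 (Finset.mem_range.1 hj))
    have h2 : ∑ j ∈ Finset.range (k + 1), m / ((k : ℝ) + 1) = m := by
      simp
      field_simp
    rw [h2] at h1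
    exact absurd (hmQ _ hmem) (not_le.2 h1)
  · intro t ht
    have := hM ((ζ, u), t) ⟨hmem, abs_le.1 ht⟩
    exact this.trans ((le_abs_self M).trans (by linarith))

/-- Dilating a nearby boundary point about `ζ` by a bounded factor, positive or negative, and
then pushing it inwards by a multiple of its height leads to a point of `K`. -/
theorem SmoothBody.exists_dilate_mem {d k : ℕ} {K : Set (Euc d)} {F : Euc d → ℝ}
    (hK : SmoothBody d K F) (hft : FiniteTypeOrd d k K F) :
    ∃ r C : ℝ, 0 < r ∧ 0 < C ∧ ∀ ζ ∈ frontier K, ∀ x ∈ frontier K, ‖x - ζ‖ < r → x ≠ ζ →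
      0 < ⟪nrml d F ζ, ζ - x⟫ ∧ ∀ l : ℝ, |l| ≤ 4 →
        ζ + l • (x - ζ) - (C * ⟪nrml d F ζ, ζ - x⟫) • nrml d F ζ ∈ K := by
  obtain ⟨r₁, c, L, hN⟩ := hK.exists_normalBounds
  have hc := hN.pos_c
  have hL := hN.pos_L
  have hr₁ := hN.pos_r
  obtain ⟨c₂, M, hc₂, hM, htype⟩ := hK.exists_uniform_type hft
  obtain ⟨r₂, C₁, hr₂, hC₁, hdoub⟩ :=
    exists_doubling_of_finite_type k hc₂ hM (B := L / c) (by positivity)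
  set C : ℝ := C₁ * L / c + 4 with hC
  have hC4 : 4 < C := by
    have : 0 < C₁ * L / c := by positivity
    linarith
  have hC0 : 0 < C := by linarith
  clear_value C
  refine ⟨min (r₂ / 2) (min (r₁ / (2 * (1 + L / c))) (r₁ / (12 + C))),
    C, by positivity, hC0, fun ζ hζ x hx hxr hne => ?_⟩
  have hx2 : 2 * ‖x - ζ‖ < r₂ := by
    have := hxr.trans_le (min_le_left _ _); linarith
  have hx3 : (1 + L / c) * (2 * ‖x - ζ‖) < r₁ := by
    have := hxr.trans_le ((min_le_right _ _).trans (min_le_left _ _))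
    rw [lt_div_iff₀ (by positivity)] at this
    linarith
  have hx4 : (12 + C) * ‖x - ζ‖ < r₁ := by
    have := hxr.trans_le ((min_le_right _ _).trans (min_le_right _ _))
    rw [lt_div_iff₀ (by positivity)] at this
    linarith
  have hxζ : 0 < ‖x - ζ‖ := norm_pos_iff.2 (sub_ne_zero.2 hne)
  set n := nrml d F ζ with hn
  have hn1 : ‖n‖ = 1 := hK.norm_nrml hζ
  set h := ⟪n, ζ - x⟫ with hh
  have hh0 : 0 ≤ h := hK.inner_nrml_nonneg hζ (hK.mem_of_mem_frontier hx)
  have hhx : h ≤ ‖x - ζ‖ := by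
    have := real_inner_le_norm n (ζ - x)
    rwa [hn1, one_mul, norm_sub_rev] at this
  set v := x - ζ + h • n with hv
  have hnv : ⟪n, v⟫ = 0 := by
    rw [hv, inner_add_right, real_inner_smul_right, hK.inner_nrml_self hζ, hh, ← neg_sub x ζ,
      inner_neg_right]
    ring
  have hvx : ‖v‖ ≤ 2 * ‖x - ζ‖ := by
    refine (norm_add_le _ _).trans ?_
    rw [norm_smul, hn1, Real.norm_of_nonneg hh0]
    linarith
  have hxv : ζ + v = x + h • n := by rw [hv]; abel
  have hxball : ‖x - ζ‖ < r₁ := by nlinarith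
  have hvball : ‖v‖ < r₁ := by nlinarith
  have hFx := hK.mem_frontier_iff.1 hx
  have hup : F (ζ + v) ≤ L * h := by
    have := hN.sub_le hK hζ hh0 hxball (by rw [← hn, ← hxv]; simpa using hvball)
    rw [← hn, ← hxv, hFx, sub_zero] at this
    exact this
  have hv0 : v ≠ 0 := by
    intro h0
    have := hN.le_sub hK hζ hh0 hxball (by rw [← hn, ← hxv]; simpa using hvball)
    rw [← hn, ← hxv, hFx, h0, add_zero, hK.mem_frontier_iff.1 hζ, sub_zero] at this
    have hz : h = 0 := le_antisymm (nonpos_of_mul_nonpos_right this hc) hh0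
    rw [h0, add_zero, hz, zero_smul, add_zero] at hxv
    exact hne hxv.symm
  have ht0 : 0 < ‖v‖ := norm_pos_iff.2 hv0
  set u := ‖v‖⁻¹ • v with hu
  have hu1 : ‖u‖ = 1 := by
    rw [hu, norm_smul, norm_inv, norm_norm, inv_mul_cancel₀ ht0.ne']
  have hnu : ⟪n, u⟫ = 0 := by rw [hu, real_inner_smul_right, hnv, mul_zero]
  have hlu : ∀ l : ℝ, (l * ‖v‖) • u = l • v := by
    intro l
    rw [hu, smul_smul, mul_assoc, mul_inv_cancel₀ ht0.ne', mul_one]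
  have hlu1 : ‖v‖ • u = v := by simpa using hlu 1
  obtain ⟨hj, hMt⟩ := htype ζ hζ u hu1 hnu
  have hgs : ContDiff ℝ (⊤ : ℕ∞) fun t : ℝ => F (ζ + t • u) := by
    have := hK.contDiff
    fun_prop
  obtain ⟨hpos, hl⟩ := hdoub _ hgs hj hMt ‖v‖ ht0 (hvx.trans_lt hx2) (by
    intro τ hτ
    rw [hlu, hlu1]
    refine hN.abs_le_of_tangent hK hζ hnv ?_ ⟨hτ.1.le, hτ.2⟩
    refine lt_of_le_of_lt ?_ hx3
    gcongr)
  simp only [hlu, hlu1] at hpos hl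
  have hhpos : 0 < h := pos_of_mul_pos_right (hpos.trans_le hup) hL.le
  refine ⟨hhpos, fun l hl4 => ?_⟩
  obtain ⟨hl1, hl2⟩ := abs_le.1 hl4
  have ha0 : 0 ≤ (C + l) * h := mul_nonneg (by linarith) hh0
  have heq : ζ + l • (x - ζ) - (C * h) • n = ζ + l • v - ((C + l) * h) • n := by
    rw [hv]
    module
  have hlv : ‖l • v‖ ≤ 8 * ‖x - ζ‖ := by
    rw [norm_smul, Real.norm_eq_abs]
    nlinarith [norm_nonneg v, abs_nonneg l]
  rw [heq]
  refine hN.sub_smul_mem hK hζ ha0 ?_ ?_ ?_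
  · rw [add_sub_cancel_left]
    refine hlv.trans_lt ?_
    nlinarith
  · rw [← hn, show ζ + l • v - ((C + l) * h) • n - ζ = l • v - ((C + l) * h) • n by abel]
    refine (norm_sub_le _ _).trans_lt ?_
    rw [norm_smul ((C + l) * h), hn1, mul_one, Real.norm_of_nonneg ha0]
    have : (C + l) * h ≤ (C + 4) * ‖x - ζ‖ := by gcongr
    linarith
  · calc F (ζ + l • v) ≤ C₁ * F (ζ + v) := hl l hl4
      _ ≤ C₁ * (L * h) := by gcongr
      _ = c * (C₁ * L / c * h) := by field_simp
      _ ≤ c * ((C + l) * h) := by gcongr; linarith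

namespace SmoothBody

section

variable {d k : ℕ} {K : Set (Euc d)} {F : Euc d → ℝ}

theorem mem_cap_iff (hK : SmoothBody d K F) {ζ x : Euc d} (hζ : ζ ∈ frontier K) {s : ℝ} :
    x ∈ cap d K F ζ s ↔ x ∈ frontier K ∧ ⟪nrml d F ζ, ζ - x⟫ < s := by
  refine and_congr_right fun hx => ?_
  rw [← abs_neg, ← inner_neg_right, neg_sub,
    abs_of_nonneg (hK.inner_nrml_nonneg hζ (hK.mem_of_mem_frontier hx))]

/-- The tangent hyperplane at a boundary point meets the boundary only at that point. -/
theorem inner_nrml_pos (hK : SmoothBody d K F) (hft : FiniteTypeOrd d k K F) {ζ x : Euc d}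
    (hζ : ζ ∈ frontier K) (hx : x ∈ frontier K) (hne : x ≠ ζ) : 0 < ⟪nrml d F ζ, ζ - x⟫ := by
  refine (hK.inner_nrml_nonneg hζ (hK.mem_of_mem_frontier hx)).lt_of_ne' fun h0 => ?_
  obtain ⟨r, C, hr, -, hdil⟩ := hK.exists_dilate_mem hft
  have hxζ : 0 < ‖x - ζ‖ := norm_pos_iff.2 (sub_ne_zero.2 hne)
  obtain ⟨τ, hτ0, hτ⟩ : ∃ τ : ℝ, 0 < τ ∧ τ < min 1 (r / ‖x - ζ‖) := exists_between (by positivity)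
  have hτr : τ * ‖x - ζ‖ < r := by
    rw [← lt_div_iff₀ hxζ]; exact hτ.trans_le (min_le_right _ _)
  have hin : ⟪nrml d F ζ, τ • (x - ζ)⟫ = 0 := by
    rw [real_inner_smul_right, ← neg_sub, inner_neg_right, h0]; simp
  have hyK : ζ + τ • (x - ζ) ∈ K := hK.2.1.add_smul_sub_mem (hK.mem_of_mem_frontier hζ)
    (hK.mem_of_mem_frontier hx) ⟨hτ0.le, (hτ.trans_le (min_le_left _ _)).le⟩
  have hy : ζ + τ • (x - ζ) ∈ frontier K :=
    hK.mem_frontier_iff.2 (le_antisymm (hK.mem_iff.1 hyK) (hK.nonneg_of_tangent hζ hin))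
  have := (hdil ζ hζ _ hy (by
    rwa [add_sub_cancel_left, norm_smul, Real.norm_of_nonneg hτ0.le]) (by
    simp [hτ0.ne', sub_ne_zero.2 hne])).1
  rw [sub_add_cancel_left, inner_neg_right, hin] at this
  simp at this

/-- Caps of small height have small diameter, uniformly in the centre. -/
theorem exists_cap_subset_ball (hK : SmoothBody d K F) (hft : FiniteTypeOrd d k K F) {r : ℝ}
    (hr : 0 < r) : ∃ s₀ : ℝ, 0 < s₀ ∧ ∀ ζ ∈ frontier K, ∀ x ∈ frontier K,
      ⟪nrml d F ζ, ζ - x⟫ < s₀ → ‖x - ζ‖ < r := by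
  have hQ : IsCompact ((frontier K ×ˢ frontier K) ∩ {p | r ≤ ‖p.2 - p.1‖}) :=
    (hK.isCompact_frontier.prod hK.isCompact_frontier).inter_right
      (isClosed_le continuous_const (by fun_prop))
  have hcont : ContinuousOn (fun p : Euc d × Euc d => ⟪nrml d F p.1, p.1 - p.2⟫)
      ((frontier K ×ˢ frontier K) ∩ {p | r ≤ ‖p.2 - p.1‖}) := by
    refine ContinuousOn.inner (𝕜 := ℝ) ?_ (by fun_prop)
    exact hK.continuousOn_nrml.comp continuousOn_fst fun p hp => hp.1.1
  obtain ⟨s₀, hs₀, h⟩ := hQ.exists_forall_le' (a := 0) hcont (by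
    rintro ⟨ζ, x⟩ ⟨⟨hζ, hx⟩, hζx⟩
    refine hK.inner_nrml_pos hft hζ hx fun (h : x = ζ) => ?_
    have : r ≤ ‖x - ζ‖ := hζx
    rw [h, sub_self, norm_zero] at this
    exact this.not_gt hr)
  refine ⟨s₀, hs₀, fun ζ hζ x hx hlt => ?_⟩
  by_contra! hle
  exact absurd (h (ζ, x) ⟨⟨hζ, hx⟩, hle⟩) (not_le.2 hlt)

/-- Engulfing: two points in a small cap are contained in each other's caps of comparable
height. -/
theorem exists_engulfing (hK : SmoothBody d K F) (hft : FiniteTypeOrd d k K F) :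
    ∃ s₀ C : ℝ, 0 < s₀ ∧ 0 < C ∧ ∀ ζ ∈ frontier K, ∀ ξ ∈ frontier K, ∀ η ∈ frontier K,
      ∀ s ≤ s₀, ⟪nrml d F ζ, ζ - ξ⟫ < s → ⟪nrml d F ζ, ζ - η⟫ < s →
        ⟪nrml d F ξ, ξ - η⟫ < C * s := by
  obtain ⟨r, C, hr, hC, hdil⟩ := hK.exists_dilate_mem hft
  obtain ⟨s₀, hs₀, hball⟩ := hK.exists_cap_subset_ball hft hr
  refine ⟨s₀, C, hs₀, hC, fun ζ hζ ξ hξ η hη s hs hζξ hζη => ?_⟩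
  have hdil' : ∀ x ∈ frontier K, ⟪nrml d F ζ, ζ - x⟫ < s → ∀ l : ℝ, |l| ≤ 4 →
      ζ + l • (x - ζ) - (C * ⟪nrml d F ζ, ζ - x⟫) • nrml d F ζ ∈ K := by
    intro x hx hlt l hl
    rcases eq_or_ne x ζ with rfl | hne
    · simpa using hK.mem_of_mem_frontier hx
    · exact (hdil ζ hζ x hx (hball ζ hζ x hx (hlt.trans_le hs)) hne).2 l hl
  have hp := hdil' ξ hξ hζξ 4 (by norm_num)
  have hq := hdil' η hη hζη (-2) (by norm_num)
  have ha0 := hK.inner_nrml_nonneg hζ (hK.mem_of_mem_frontier hξ)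
  have hb0 := hK.inner_nrml_nonneg hζ (hK.mem_of_mem_frontier hη)
  set a := ⟪nrml d F ζ, ζ - ξ⟫
  set b := ⟪nrml d F ζ, ζ - η⟫
  have hm := hK.2.1 hp hq (show (0 : ℝ) ≤ 1 / 2 by norm_num) (show (0 : ℝ) ≤ 1 / 2 by norm_num)
    (by norm_num)
  have h := hK.inner_nrml_nonneg hξ hm
  have heq : ξ - ((1 / 2 : ℝ) • (ζ + (4 : ℝ) • (ξ - ζ) - (C * a) • nrml d F ζ)
      + (1 / 2 : ℝ) • (ζ + (-2 : ℝ) • (η - ζ) - (C * b) • nrml d F ζ))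
      = (C * (a + b) / 2) • nrml d F ζ - (ξ - η) := by
    module
  rw [heq, inner_sub_right, real_inner_smul_right] at h
  have h1 : ⟪nrml d F ξ, nrml d F ζ⟫ ≤ 1 := by
    have := real_inner_le_norm (nrml d F ξ) (nrml d F ζ)
    rwa [hK.norm_nrml hζ, hK.norm_nrml hξ, one_mul] at this
  have h2 : C * (a + b) / 2 * ⟪nrml d F ξ, nrml d F ζ⟫ ≤ C * (a + b) / 2 :=
    mul_le_of_le_one_right (by positivity) h1
  have h3 : C * (a + b) / 2 < C * s := by nlinarith
  linarith

/-- Doubling property of the surface measure of small caps. -/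
theorem exists_doubling_cap (hK : SmoothBody d K F) (hft : FiniteTypeOrd d k K F) (hd : 1 ≤ d) :
    ∃ s₀ : ℝ, 0 < s₀ ∧ ∀ ζ ∈ frontier K, ∀ (l : NNReal) (s : ℝ), 1 ≤ l → l * s ≤ s₀ →
      μH[(d : ℝ) - 1] (cap d K F ζ (l * s)) ≤
        (l : ℝ≥0∞) ^ ((d : ℝ) - 1) * μH[(d : ℝ) - 1] (cap d K F ζ s) := by
  obtain ⟨r, c, L, hN⟩ := hK.exists_normalBounds
  obtain ⟨s₀, hs₀, hball⟩ := hK.exists_cap_subset_ball hft hN.pos_r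
  refine ⟨s₀, hs₀, fun ζ hζ l s hl hls => ?_⟩
  have hl1 : (1 : ℝ) ≤ l := by exact_mod_cast hl
  have hl0 : (0 : ℝ) < l := by linarith
  have hd' : (0 : ℝ) ≤ (d : ℝ) - 1 := by
    have : (1 : ℝ) ≤ d := by exact_mod_cast hd
    linarith
  refine hausdorffMeasure_le_of_rel
    (fun x y => ∃ t : ℝ, 0 ≤ t ∧ ζ + (l : ℝ) • (y - ζ) = x + t • nrml d F x) hd' ?_ ?_
  · intro x hx
    obtain ⟨hxΓ, hxs⟩ := (hK.mem_cap_iff hζ).1 hx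
    let y : ℝ → Euc d := fun t => ζ + (l : ℝ)⁻¹ • (x + t • nrml d F x - ζ)
    have hyc : Continuous y := by fun_prop
    have hy0 : F (y 0) ≤ 0 := by
      refine hK.mem_iff.1 ?_
      have := hK.2.1.add_smul_sub_mem (hK.mem_of_mem_frontier hζ) (hK.mem_of_mem_frontier hxΓ)
        (t := (l : ℝ)⁻¹) ⟨by positivity, inv_le_one_of_one_le₀ hl1⟩
      simpa [y] using this
    obtain ⟨R, hR⟩ := hK.1.isBounded.exists_norm_le
    obtain ⟨T, hT0, hT⟩ : ∃ T : ℝ, 0 ≤ T ∧ 0 ≤ F (y T) := by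
      refine ⟨l * (‖ζ‖ + |R| + 1) + ‖x - ζ‖, by positivity, ?_⟩
      set T : ℝ := l * (‖ζ‖ + |R| + 1) + ‖x - ζ‖ with hTdef
      have hT0 : 0 ≤ T := by positivity
      by_contra! hneg
      have h1 := hR _ (hK.mem_iff.2 hneg.le)
      have h2 : T • nrml d F x = (l : ℝ) • (y T - ζ) - (x - ζ) := by
        simp only [y, add_sub_cancel_left]
        rw [smul_inv_smul₀ hl0.ne']; abel
      have h3 : T = ‖T • nrml d F x‖ := by
        rw [norm_smul, hK.norm_nrml hxΓ, mul_one, Real.norm_of_nonneg hT0]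
      have h4 : T ≤ l * (R + ‖ζ‖) + ‖x - ζ‖ := by
        calc T = ‖(l : ℝ) • (y T - ζ) - (x - ζ)‖ := by rw [← h2, ← h3]
          _ ≤ ‖(l : ℝ) • (y T - ζ)‖ + ‖x - ζ‖ := norm_sub_le _ _
          _ ≤ l * (R + ‖ζ‖) + ‖x - ζ‖ := by
            rw [norm_smul, Real.norm_of_nonneg hl0.le]
            gcongr
            exact (norm_sub_le _ _).trans (by gcongr)
      nlinarith [le_abs_self R]
    have hcont : ContinuousOn (fun t => F (y t)) (Icc 0 T) :=
      (hK.contDiff.continuous.comp hyc).continuousOn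
    obtain ⟨t, ht, htF⟩ := intermediate_value_Icc hT0 hcont ⟨hy0, hT⟩
    have htF' : F (y t) = 0 := htF
    have hexp : ζ + (l : ℝ) • (y t - ζ) = x + t • nrml d F x := by
      simp only [y, add_sub_cancel_left]
      rw [smul_inv_smul₀ hl0.ne']; abel
    refine ⟨y t, (hK.mem_cap_iff hζ).2 ⟨hK.mem_frontier_iff.2 htF', ?_⟩, t, ht.1, hexp⟩
    have hnn : 0 ≤ ⟪nrml d F ζ, nrml d F x⟫ :=
      (div_pos hN.pos_c hN.pos_L).le.trans
        (hN.le_inner_nrml hK hζ hxΓ (hball ζ hζ x hxΓ (hxs.trans_le hls)))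
    have h1 : (l : ℝ) * ⟪nrml d F ζ, ζ - y t⟫ =
        ⟪nrml d F ζ, ζ - x⟫ - t * ⟪nrml d F ζ, nrml d F x⟫ := by
      rw [← real_inner_smul_right, ← real_inner_smul_right, ← inner_sub_right]
      congr 1
      have : (l : ℝ) • (ζ - y t) = ζ - (ζ + (l : ℝ) • (y t - ζ)) := by module
      rw [this, hexp]; abel
    have h2 := mul_nonneg ht.1 hnn
    exact lt_of_mul_lt_mul_left (by linarith) hl0.le
  · rintro x hx x' hx' y y' ⟨t, ht, hty⟩ ⟨t', ht', hty'⟩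
    refine (hK.dist_le_dist_add_nrml hx.1 hx'.1 ht ht').trans ?_
    rw [← hty, ← hty', dist_add_left, dist_smul₀, Real.norm_of_nonneg hl0.le, dist_sub_right]

end

end SmoothBody

theorem finrank_orthogonal_nrml {d : ℕ} {K : Set (Euc d)} {F : Euc d → ℝ}
    (hK : SmoothBody d K F) (hd : 1 ≤ d) {ζ : Euc d} (hζ : ζ ∈ frontier K) :
    ((Module.finrank ℝ (ℝ ∙ nrml d F ζ)ᗮ : ℕ) : ℝ) = (d : ℝ) - 1 := by
  obtain ⟨m, rfl⟩ : ∃ m, d = m + 1 := ⟨d - 1, by omega⟩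
  have : Fact (Module.finrank ℝ (Euc (m + 1)) = m + 1) := ⟨by simp⟩
  have hn : nrml (m + 1) F ζ ≠ 0 := by
    rw [← norm_pos_iff, hK.norm_nrml hζ]
    exact one_pos
  rw [Submodule.finrank_orthogonal_span_singleton (n := m) hn]
  push_cast
  ring

namespace SmoothBody

section

variable {d k : ℕ} {K : Set (Euc d)} {F : Euc d → ℝ}

theorem hausdorffMeasure_frontier_lt_top (hK : SmoothBody d K F) (hd : 1 ≤ d) :
    μH[(d : ℝ) - 1] (frontier K) < ⊤ := by
  obtain ⟨r, c, L, hN⟩ := hK.exists_normalBounds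
  have hr := hN.pos_r
  have hc := hN.pos_c
  have hL := hN.pos_L
  have hd' : (0 : ℝ) ≤ (d : ℝ) - 1 := by
    have : (1 : ℝ) ≤ d := by exact_mod_cast hd
    linarith
  refine hK.isCompact_frontier.measure_lt_top_of_nhdsWithin fun ζ hζ => ?_
  refine ⟨Metric.ball ζ r ∩ frontier K, Filter.inter_mem
    (mem_nhdsWithin_of_mem_nhds (Metric.ball_mem_nhds ζ hr)) self_mem_nhdsWithin, ?_⟩
  set n := nrml d F ζ with hn
  have hn1 : ‖n‖ = 1 := hK.norm_nrml hζ
  have hnn : ⟪n, n⟫ = 1 := hK.inner_nrml_self hζ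
  set ρ : ℝ := r + (1 + r) * (L / c) + 1 with hρ
  have hle := hausdorffMeasure_le_of_rel (X := Euc d) (Y := ↥(ℝ ∙ n)ᗮ)
    (fun x y => ∃ t : ℝ, 0 ≤ t ∧ x + t • nrml d F x = ζ + n + (y : Euc d))
    (A := Metric.ball ζ r ∩ frontier K) (B := Metric.closedBall 0 ρ) (L := 1) hd' (by
      rintro x ⟨hxr, hx⟩
      have hxr' : ‖x - ζ‖ < r := by simpa [dist_eq_norm] using hxr
      have hlow := hN.le_inner_nrml hK hζ hx hxr'
      rw [← hn] at hlow
      have hcL : 0 < c / L := by positivity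
      have hh0 : 0 ≤ ⟪n, ζ - x⟫ := hK.inner_nrml_nonneg hζ (hK.mem_of_mem_frontier hx)
      have hh1 : ⟪n, ζ - x⟫ ≤ r := by
        have := real_inner_le_norm n (ζ - x)
        rw [hn1, one_mul, norm_sub_rev] at this
        linarith
      set q := ⟪n, nrml d F x⟫ with hq
      have hq0 : 0 < q := hcL.trans_le hlow
      set t := (1 + ⟪n, ζ - x⟫) / q with ht
      have ht0 : 0 ≤ t := by positivity
      have htq : t * q = 1 + ⟪n, ζ - x⟫ := div_mul_cancel₀ _ hq0.ne'
      have ht1 : t ≤ (1 + r) * (L / c) := by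
        calc t ≤ (1 + r) / (c / L) := by rw [ht]; gcongr
          _ = (1 + r) * (L / c) := by field_simp
      have hmem : x + t • nrml d F x - ζ - n ∈ (ℝ ∙ n)ᗮ := by
        rw [Submodule.mem_orthogonal_singleton_iff_inner_right,
          show x + t • nrml d F x - ζ - n = t • nrml d F x - (ζ - x) - n by abel,
          inner_sub_right, inner_sub_right, real_inner_smul_right, hnn, ← hq, htq]
        ring
      refine ⟨⟨_, hmem⟩, ?_, t, ht0, ?_⟩
      · rw [mem_closedBall_zero_iff]
        show ‖x + t • nrml d F x - ζ - n‖ ≤ ρ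
        rw [show x + t • nrml d F x - ζ - n = (x - ζ) + t • nrml d F x - n by abel]
        refine (norm_sub_le _ _).trans ?_
        have h1 := norm_add_le (x - ζ) (t • nrml d F x)
        rw [norm_smul t, hK.norm_nrml hx, mul_one, Real.norm_of_nonneg ht0] at h1
        rw [hn1, hρ]
        linarith
      · show x + t • nrml d F x = ζ + n + (x + t • nrml d F x - ζ - n)
        abel) (by
      rintro x ⟨-, hx⟩ x' ⟨-, hx'⟩ y y' ⟨t, ht, hty⟩ ⟨t', ht', hty'⟩
      refine (hK.dist_le_dist_add_nrml hx hx' ht ht').trans ?_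
      rw [hty, hty', dist_add_left, NNReal.coe_one, one_mul]
      rfl)
  refine hle.trans_lt ?_
  rw [ENNReal.coe_one, ENNReal.one_rpow, one_mul, ← finrank_orthogonal_nrml hK hd hζ]
  exact (ProperSpace.isCompact_closedBall 0 ρ).measure_lt_top

theorem hausdorffMeasure_frontier_inter_ball_pos (hK : SmoothBody d K F) (hd : 1 ≤ d)
    {ζ : Euc d} (hζ : ζ ∈ frontier K) {ρ : ℝ} (hρ : 0 < ρ) :
    0 < μH[(d : ℝ) - 1] (frontier K ∩ Metric.ball ζ ρ) := by
  obtain ⟨r, c, L, hN⟩ := hK.exists_normalBounds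
  have hr := hN.pos_r
  have hc := hN.pos_c
  have hL := hN.pos_L
  have hd' : (0 : ℝ) ≤ (d : ℝ) - 1 := by
    have : (1 : ℝ) ≤ d := by exact_mod_cast hd
    linarith
  set n := nrml d F ζ with hn
  have hn1 : ‖n‖ = 1 := hK.norm_nrml hζ
  set ε := min r ρ / 4 with hε
  have hε0 : 0 < ε := by positivity
  have hεr : 4 * ε ≤ r := by rw [hε]; linarith [min_le_left r ρ]
  have hερ : 4 * ε ≤ ρ := by rw [hε]; linarith [min_le_right r ρ]
  set δ := min ε (c * ε / L) with hδ
  have hδ0 : 0 < δ := by positivity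
  have hle := hausdorffMeasure_le_of_rel (X := ↥(ℝ ∙ n)ᗮ) (Y := Euc d)
    (fun y x => ∃ τ : ℝ, x = ζ + (y : Euc d) + τ • n)
    (A := Metric.ball 0 δ) (B := frontier K ∩ Metric.ball ζ ρ) (L := 1) hd' (by
      rintro ⟨y, hyn⟩ hy
      have hyδ : ‖y‖ < δ := by simpa using hy
      have hyε : ‖y‖ < ε := hyδ.trans_le (min_le_left _ _)
      have hyL : L * ‖y‖ < c * ε := by
        have := hyδ.trans_le (min_le_right _ _)
        rw [lt_div_iff₀ hL] at this
        linarith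
      have hball : ∀ τ ∈ Icc (-ε) ε, ‖y + τ • n‖ < 2 * ε := by
        intro τ hτ
        have h1 := norm_add_le y (τ • n)
        rw [norm_smul, hn1, mul_one, Real.norm_eq_abs] at h1
        have := abs_le.2 hτ
        linarith
      have hFy := abs_le.1 (hN.abs_sub_le hK hζ (x := ζ + y) (by
        rw [add_sub_cancel_left]; linarith))
      rw [add_sub_cancel_left] at hFy
      have hlt : ∀ τ ∈ Icc (-ε) ε, ‖ζ + y + τ • n - ζ‖ < r := by
        intro τ hτ
        rw [add_assoc, add_sub_cancel_left]
        linarith [hball τ hτ]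
      have h0 : ‖ζ + y - ζ‖ < r := by rw [add_sub_cancel_left]; linarith
      have hup := hN.le_sub hK hζ hε0.le h0 (hlt ε ⟨by linarith, le_rfl⟩)
      have hback : ζ + y + (-ε) • n + ε • n = ζ + y := by module
      have hdown := hN.le_sub hK hζ (x := ζ + y + (-ε) • n) hε0.le
        (hlt (-ε) ⟨le_rfl, by linarith⟩) (by rw [← hn, hback]; exact h0)
      rw [← hn] at hup hdown
      rw [hback] at hdown
      have hcont : ContinuousOn (fun τ : ℝ => F (ζ + y + τ • n)) (Icc (-ε) ε) := by
        have := hK.contDiff.continuous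
        fun_prop
      obtain ⟨τ, hτ, hFτ⟩ := intermediate_value_Icc (by linarith : -ε ≤ ε) hcont
        (show (0 : ℝ) ∈ Icc _ _ from ⟨by linarith, by linarith⟩)
      refine ⟨ζ + y + τ • n, ⟨hK.mem_frontier_iff.2 hFτ, ?_⟩, τ, rfl⟩
      rw [Metric.mem_ball, dist_eq_norm, add_assoc, add_sub_cancel_left]
      linarith [hball τ hτ]) (by
      rintro ⟨y, hy⟩ - ⟨y', hy'⟩ - x x' ⟨τ, rfl⟩ ⟨τ', rfl⟩
      show dist y y' ≤ 1 * dist (ζ + y + τ • n) (ζ + y' + τ' • n)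
      rw [one_mul, dist_eq_norm, dist_eq_norm,
        show ζ + y + τ • n - (ζ + y' + τ' • n) = (y - y') + (τ - τ') • n by module]
      have h1 : ⟪y - y', (τ - τ') • n⟫ = 0 := by
        rw [Submodule.mem_orthogonal_singleton_iff_inner_left] at hy hy'
        rw [real_inner_smul_right, inner_sub_left, hy, hy']
        simp
      have h2 := norm_add_sq_eq_norm_sq_add_norm_sq_of_inner_eq_zero _ _ h1
      nlinarith [norm_nonneg (y - y'), norm_nonneg (y - y' + (τ - τ') • n),
        mul_self_nonneg ‖(τ - τ') • n‖])
  rw [ENNReal.coe_one, ENNReal.one_rpow, one_mul] at hle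
  refine lt_of_lt_of_le ?_ hle
  rw [← finrank_orthogonal_nrml hK hd hζ]
  exact Metric.measure_ball_pos _ _ hδ0

theorem exists_le_hausdorffMeasure_frontier_inter_ball (hK : SmoothBody d K F) (hd : 1 ≤ d)
    {ρ : ℝ} (hρ : 0 < ρ) : ∃ m : ℝ≥0∞, 0 < m ∧ ∀ ζ ∈ frontier K,
      m ≤ μH[(d : ℝ) - 1] (frontier K ∩ Metric.ball ζ ρ) := by
  refine hK.isCompact_frontier.induction_on (p := fun S => ∃ m : ℝ≥0∞, 0 < m ∧ ∀ ζ ∈ S,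
      m ≤ μH[(d : ℝ) - 1] (frontier K ∩ Metric.ball ζ ρ)) ⟨1, one_pos, by simp⟩ ?_ ?_ ?_
  · rintro S T hST ⟨m, hm, h⟩
    exact ⟨m, hm, fun ζ hζ => h ζ (hST hζ)⟩
  · rintro S T ⟨m, hm, h⟩ ⟨m', hm', h'⟩
    refine ⟨min m m', lt_min hm hm', ?_⟩
    rintro ζ (hζ | hζ)
    · exact (min_le_left _ _).trans (h ζ hζ)
    · exact (min_le_right _ _).trans (h' ζ hζ)
  · intro ζ hζ
    refine ⟨Metric.ball ζ (ρ / 2), mem_nhdsWithin_of_mem_nhds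
      (Metric.ball_mem_nhds ζ (half_pos hρ)), _,
      hK.hausdorffMeasure_frontier_inter_ball_pos hd hζ (half_pos hρ), fun ξ hξ => ?_⟩
    refine measure_mono (inter_subset_inter_right _ (Metric.ball_subset_ball' ?_))
    have : dist ζ ξ < ρ / 2 := by rw [dist_comm]; exact hξ
    linarith

theorem frontier_inter_ball_subset_cap (hK : SmoothBody d K F) {ζ : Euc d}
    (hζ : ζ ∈ frontier K) (s : ℝ) : frontier K ∩ Metric.ball ζ s ⊆ cap d K F ζ s := by
  rintro x ⟨hx, hxs⟩
  refine ⟨hx, (abs_real_inner_le_norm _ _).trans_lt ?_⟩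
  rw [hK.norm_nrml hζ, one_mul, ← dist_eq_norm]
  exact hxs

end

end SmoothBody

/-- Comparability of the surface measure of caps centered at nearby points (2.3). -/
theorem stmt10 (d k : ℕ) (hd : 2 ≤ d) (hk : 2 ≤ k) (K : Set (Euc d)) (F : Euc d → ℝ)
    (hK : SmoothBody d K F) (hft : FiniteTypeOrd d k K F) :
    ∃ C : ℝ, 0 < C ∧ ∀ ξ₀ ∈ frontier K, ∀ s : ℝ, 0 < s → ∀ ξ ∈ cap d K F ξ₀ s,
      μH[(d : ℝ) - 1] (cap d K F ξ₀ s) ≤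
          ENNReal.ofReal C * μH[(d : ℝ) - 1] (cap d K F ξ s) ∧
      μH[(d : ℝ) - 1] (cap d K F ξ s) ≤
          ENNReal.ofReal C * μH[(d : ℝ) - 1] (cap d K F ξ₀ s) := by
  have hd1 : 1 ≤ d := by omega
  have hd' : (0 : ℝ) ≤ (d : ℝ) - 1 := by
    have : (1 : ℝ) ≤ d := by exact_mod_cast hd1
    linarith
  obtain ⟨s₁, A, hs₁, hA, heng⟩ := hK.exists_engulfing hft
  obtain ⟨s₂, hs₂, hdoub⟩ := hK.exists_doubling_cap hft hd1
  obtain ⟨B, hAB, hB1⟩ : ∃ B : ℝ, A ≤ B ∧ 1 ≤ B := ⟨max A 1, le_max_left _ _, le_max_right _ _⟩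
  have hB0 : 0 < B := by linarith
  have hBB : B ≤ B * B := le_mul_of_one_le_left hB0.le hB1
  set s₀ : ℝ := min (s₁ / B) (s₂ / (B * B)) with hs₀
  have hs₀0 : 0 < s₀ := by positivity
  let l : NNReal := ⟨B * B, by positivity⟩
  have hl1 : 1 ≤ l := by
    have : (1 : ℝ) ≤ B * B := hB1.trans hBB
    exact_mod_cast this
  obtain ⟨m, hm, hmle⟩ := hK.exists_le_hausdorffMeasure_frontier_inter_ball hd1 hs₀0
  have hfin := hK.hausdorffMeasure_frontier_lt_top hd1
  set T := μH[(d : ℝ) - 1] (frontier K) with hT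
  have hlpow : (l : ℝ≥0∞) ^ ((d : ℝ) - 1) < ⊤ :=
    ENNReal.rpow_lt_top_of_nonneg hd' ENNReal.coe_ne_top
  set D : ℝ≥0∞ := (l : ℝ≥0∞) ^ ((d : ℝ) - 1) + T / m + 1 with hD
  have hDtop : D ≠ ⊤ := by
    refine (ENNReal.add_lt_top.2 ⟨ENNReal.add_lt_top.2 ⟨hlpow, ?_⟩, ENNReal.one_lt_top⟩).ne
    exact ENNReal.div_lt_top hfin.ne hm.ne'
  refine ⟨D.toReal, ENNReal.toReal_pos (by simp [hD]) hDtop, ?_⟩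
  rw [ENNReal.ofReal_toReal hDtop]
  intro ξ₀ hξ₀ s hs ξ hξ
  have hξΓ : ξ ∈ frontier K := hξ.1
  rcases lt_or_ge s s₀ with hlt | hge
  · have hsB : B * s ≤ s₁ := by
      have := hlt.le.trans (min_le_left _ _)
      rw [le_div_iff₀ hB0] at this
      linarith
    have hsBB : B * B * s ≤ s₂ := by
      have := hlt.le.trans (min_le_right _ _)
      rw [le_div_iff₀ (by positivity)] at this
      linarith
    have hss : s ≤ B * s := le_mul_of_one_le_left hs.le hB1
    have hBs : B * s ≤ B * B * s := by gcongr
    have hξs := ((hK.mem_cap_iff hξ₀).1 hξ).2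
    have hsub : ∀ η ∈ frontier K, ⟪nrml d F ξ₀, ξ₀ - η⟫ < s → ⟪nrml d F ξ, ξ - η⟫ < B * s :=
      fun η hη hηs => (heng ξ₀ hξ₀ ξ hξΓ η hη s (hss.trans hsB) hξs hηs).trans_le (by gcongr)
    have hself : ⟪nrml d F ξ, ξ - ξ₀⟫ < B * s := hsub ξ₀ hξ₀ (by simpa using hs)
    have key : ∀ ζ ∈ frontier K, ∀ S : Set (Euc d), S ⊆ cap d K F ζ (B * B * s) →
        μH[(d : ℝ) - 1] S ≤ D * μH[(d : ℝ) - 1] (cap d K F ζ s) := by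
      intro ζ hζ S hS
      refine (measure_mono hS).trans ((hdoub ζ hζ l s hl1 hsBB).trans ?_)
      gcongr
      rw [hD, add_assoc]
      exact le_self_add
    constructor
    · refine key ξ hξΓ _ fun η hη => ?_
      obtain ⟨hη, hηs⟩ := (hK.mem_cap_iff hξ₀).1 hη
      exact (hK.mem_cap_iff hξΓ).2 ⟨hη, (hsub η hη hηs).trans_le hBs⟩
    · refine key ξ₀ hξ₀ _ fun η hη => ?_
      obtain ⟨hη, hηs⟩ := (hK.mem_cap_iff hξΓ).1 hη
      refine (hK.mem_cap_iff hξ₀).2 ⟨hη, ?_⟩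
      refine (heng ξ hξΓ ξ₀ hξ₀ η hη (B * s) hsB hself (hηs.trans_le hss)).trans_le ?_
      rw [mul_assoc]
      gcongr
  · have key : ∀ ζ ∈ frontier K, ∀ S ⊆ frontier K,
        μH[(d : ℝ) - 1] S ≤ D * μH[(d : ℝ) - 1] (cap d K F ζ s) := by
      intro ζ hζ S hS
      have hmT : m ≤ μH[(d : ℝ) - 1] (cap d K F ζ s) := (hmle ζ hζ).trans (measure_mono
        ((inter_subset_inter_right _ (Metric.ball_subset_ball hge)).trans
          (hK.frontier_inter_ball_subset_cap hζ s)))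
      have hmtop : m ≠ ⊤ := ne_top_of_le_ne_top hfin.ne
        (hmT.trans (measure_mono fun x hx => hx.1))
      calc μH[(d : ℝ) - 1] S ≤ T := measure_mono hS
        _ = T / m * m := (ENNReal.div_mul_cancel hm.ne' hmtop).symm
        _ ≤ D * μH[(d : ℝ) - 1] (cap d K F ζ s) := by
          gcongr
          rw [hD, add_right_comm]
          exact le_add_self
    exact ⟨key ξ hξΓ _ fun x hx => hx.1, key ξ₀ hξ₀ _ fun x hx => hx.1⟩
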